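/- arXiv:2507.17360 — 5 statements merged into one kernel-verified Lean document; each statement's English description precedes it below -/
import Mathlib

section
/- Let Δ and L be real random variables on a probability space with Δ integrable, and suppose |Δ − L| ≤ ε almost surely for a constant ε ≥ 0. Then E[Δ·(1{Δ > 0} − 1{L > 0})] ≤ ε·P(|L| ≤ ε). -/
open MeasureTheory

/-- **Regret of thresholding a working model (term T₁ in the proof of Theorem 4.2).**
If `Δ` is integrable and `|Δ - L| ≤ ε` almost surely, then
`E[Δ · (1{Δ > 0} - 1{L > 0})] ≤ ε · P(|L| ≤ ε)`. -/
theorem threshold_regret_working_model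
    {Ω : Type*} [MeasurableSpace Ω] (μ : Measure Ω) [IsProbabilityMeasure μ]
    (Δ L : Ω → ℝ) (hΔ : Integrable Δ μ) (hL : Measurable L)
    (ε : ℝ) (hε : 0 ≤ ε)
    (happrox : ∀ᵐ ω ∂μ, |Δ ω - L ω| ≤ ε) :
    ∫ ω, Δ ω * ((if Δ ω > 0 then (1 : ℝ) else 0) - (if L ω > 0 then (1 : ℝ) else 0)) ∂μ
      ≤ ε * (μ {ω | |L ω| ≤ ε}).toReal := by
  have hS : MeasurableSet {ω | |L ω| ≤ ε} :=
    measurableSet_le (measurable_abs.comp hL) measurable_const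
  have hg : Integrable (Set.indicator {ω | |L ω| ≤ ε} (fun _ => ε)) μ :=
    (integrable_const ε).indicator hS
  have hint : ∫ ω, Set.indicator {ω | |L ω| ≤ ε} (fun _ => ε) ω ∂μ
      = ε * (μ {ω | |L ω| ≤ ε}).toReal := by
    rw [integral_indicator_const ε hS, smul_eq_mul, mul_comm]
    rfl
  rw [← hint]
  refine integral_mono_of_nonneg ?_ hg ?_
  · refine Filter.Eventually.of_forall fun ω => ?_
    show (0 : ℝ) ≤ _
    dsimp only
    split_ifs <;> linarith
  · filter_upwards [happrox] with ω hω
    rw [abs_le] at hω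
    simp only [Set.indicator_apply, Set.mem_setOf_eq, abs_le]
    split_ifs with h1 h2 h3 h3 h3 <;> first
      | linarith
      | (exfalso; apply ‹¬ (-ε ≤ L ω ∧ L ω ≤ ε)›; constructor <;> linarith)
end

section
/- Let L and L̂ be integrable real random variables on a probability space. Then E[L·(1{L > 0} − 1{L̂ > 0})] ≤ E[|L̂ − L|·1{|L| ≤ |L̂ − L|}]. -/
open MeasureTheory

/-- **Regret of thresholding an estimated index (term T₂ in the proof of Theorem 4.2).**
For integrable real random variables `L` and `L̂`,
`E[L · (1{L > 0} - 1{L̂ > 0})] ≤ E[|L̂ - L| · 1{|L| ≤ |L̂ - L|}]`. -/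
theorem threshold_regret_estimated_index
    {Ω : Type*} [MeasurableSpace Ω] (μ : Measure Ω) [IsProbabilityMeasure μ]
    (L Lhat : Ω → ℝ) (hL : Integrable L μ) (hLhat : Integrable Lhat μ) :
    ∫ ω, L ω * ((if L ω > 0 then (1 : ℝ) else 0) - (if Lhat ω > 0 then (1 : ℝ) else 0)) ∂μ
      ≤ ∫ ω, |Lhat ω - L ω| * (if |L ω| ≤ |Lhat ω - L ω| then (1 : ℝ) else 0) ∂μ := by
  have hD : Integrable (fun ω => |Lhat ω - L ω|) μ := (hLhat.sub hL).abs
  have hs : NullMeasurableSet {ω | |L ω| ≤ |Lhat ω - L ω|} μ :=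
    nullMeasurableSet_le hL.abs.aemeasurable hD.aemeasurable
  apply integral_mono_of_nonneg
  · refine Filter.Eventually.of_forall fun ω => ?_
    simp only [Pi.zero_apply]
    split_ifs <;> nlinarith
  · refine (hD.indicator₀ hs).congr (Filter.Eventually.of_forall fun ω => ?_)
    simp [Set.indicator_apply]
  · refine Filter.Eventually.of_forall fun ω => ?_
    simp only
    have h1 := abs_nonneg (Lhat ω - L ω)
    split_ifs <;> grind
end

section
/- Let Δ, L, L̂ be real random variables on a probability space, with Δ integrable, L̂ − L integrable, and |Δ − L| ≤ ε almost surely for a constant ε ≥ 0. Then E[Δ·(1{Δ > 0} − 1{L̂ > 0})] ≤ ε·P(|L| ≤ ε) + E[|L̂ − L|·1{|L| ≤ |L̂ − L|}] + ε·P(|L| ≤ |L̂ − L|). -/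
open MeasureTheory

/-- **Combined decomposition T₁ + T₂ + T₃ bounding the second-stage treatment regret
(proof of Theorem 4.2).**  If `Δ` is integrable, `L̂ - L` is integrable and `|Δ - L| ≤ ε`
almost surely, then
`E[Δ · (1{Δ > 0} - 1{L̂ > 0})]
  ≤ ε · P(|L| ≤ ε) + E[|L̂ - L| · 1{|L| ≤ |L̂ - L|}] + ε · P(|L| ≤ |L̂ - L|)`. -/
theorem threshold_regret_combined
    {Ω : Type*} [MeasurableSpace Ω] (μ : Measure Ω) [IsProbabilityMeasure μ]
    (Δ L Lhat : Ω → ℝ) (hΔ : Integrable Δ μ)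
    (hL : Measurable L) (hLhat : Measurable Lhat)
    (hdiff : Integrable (fun ω => Lhat ω - L ω) μ)
    (ε : ℝ) (hε : 0 ≤ ε)
    (happrox : ∀ᵐ ω ∂μ, |Δ ω - L ω| ≤ ε) :
    ∫ ω, Δ ω * ((if Δ ω > 0 then (1 : ℝ) else 0) - (if Lhat ω > 0 then (1 : ℝ) else 0)) ∂μ
      ≤ ε * (μ {ω | |L ω| ≤ ε}).toReal
        + ∫ ω, |Lhat ω - L ω| * (if |L ω| ≤ |Lhat ω - L ω| then (1 : ℝ) else 0) ∂μ
        + ε * (μ {ω | |L ω| ≤ |Lhat ω - L ω|}).toReal := by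
  have hA : MeasurableSet {ω | |L ω| ≤ ε} :=
    measurableSet_le (by fun_prop) measurable_const
  have hB : MeasurableSet {ω | |L ω| ≤ |Lhat ω - L ω|} :=
    measurableSet_le (by fun_prop) (by fun_prop)
  have iA : Integrable ({ω | |L ω| ≤ ε}.indicator (fun _ => ε)) μ :=
    (integrable_const ε).indicator hA
  have iB : Integrable ({ω | |L ω| ≤ |Lhat ω - L ω|}.indicator (fun _ => ε)) μ :=
    (integrable_const ε).indicator hB
  have iC : Integrable
      (fun ω => |Lhat ω - L ω| * (if |L ω| ≤ |Lhat ω - L ω| then (1 : ℝ) else 0)) μ := by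
    have h := hdiff.abs.indicator hB
    refine h.congr (Filter.Eventually.of_forall fun ω => ?_)
    simp [Set.indicator_apply]
  have eA : ε * (μ {ω | |L ω| ≤ ε}).toReal
      = ∫ ω, ({ω | |L ω| ≤ ε}.indicator (fun _ => ε)) ω ∂μ := by
    rw [integral_indicator_const _ hA, smul_eq_mul, mul_comm]; rfl
  have eB : ε * (μ {ω | |L ω| ≤ |Lhat ω - L ω|}).toReal
      = ∫ ω, ({ω | |L ω| ≤ |Lhat ω - L ω|}.indicator (fun _ => ε)) ω ∂μ := by
    rw [integral_indicator_const _ hB, smul_eq_mul, mul_comm]; rfl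
  rw [eA, eB, ← integral_add' iA iC, ← integral_add' (iA.add iC) iB]
  refine integral_mono_of_nonneg (Filter.Eventually.of_forall fun ω => ?_)
    ((iA.add iC).add iB) ?_
  · simp only [Pi.zero_apply]
    split_ifs <;> linarith
  · filter_upwards [happrox] with ω h
    simp only [Pi.add_apply, Set.indicator_apply, Set.mem_setOf_eq]
    generalize Δ ω = d at *
    generalize L ω = l at *
    generalize Lhat ω = m at *
    have h1 := abs_le.mp h
    have h2 := abs_nonneg (m - l)
    split_ifs <;> grind
end

section
/- Let Δ₁,…,Δ_m and L₁,…,L_m (m ≥ 1) be real random variables on a probability space with each Δ_j integrable and |Δ_j − L_j| ≤ ε almost surely for all j, for a constant ε ≥ 0. Let D be the largest index attaining max_j Δ_j and F the largest index attaining max_j L_j. Then 0 ≤ E[Δ_D − Δ_F] ≤ 2ε·Σ_{j ≠ j'} P(|L_j − L_{j'}| ≤ 2ε). -/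
open MeasureTheory

/-- **Arm-selection regret of maximizing a working model (term T₄ in the proof of
Theorem 4.2).**  Let `Δ j` and `L j`, `j : Fin m` (`m ≥ 1`), be real random variables with
each `Δ j` integrable and `|Δ j - L j| ≤ ε` almost surely.  Let `D` be the largest index
attaining `max_j Δ j` and `F` the largest index attaining `max_j L j` (pointwise).  Then
`0 ≤ E[Δ_D - Δ_F] ≤ 2ε · Σ_{j ≠ j'} P(|L_j - L_{j'}| ≤ 2ε)`. -/
theorem argmax_regret_working_model
    {Ω : Type*} [MeasurableSpace Ω] (μ : Measure Ω) [IsProbabilityMeasure μ]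
    {m : ℕ} (hm : 1 ≤ m)
    (Δ L : Fin m → Ω → ℝ)
    (hΔint : ∀ j, Integrable (Δ j) μ)
    (hΔmeas : ∀ j, Measurable (Δ j)) (hLmeas : ∀ j, Measurable (L j))
    (ε : ℝ) (hε : 0 ≤ ε)
    (happrox : ∀ j, ∀ᵐ ω ∂μ, |Δ j ω - L j ω| ≤ ε)
    (D F : Ω → Fin m) (hDmeas : Measurable D) (hFmeas : Measurable F)
    -- `D ω` is the largest index attaining `max_j Δ j ω`
    (hDmax : ∀ ω, ∀ j, Δ j ω ≤ Δ (D ω) ω)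
    (hDlast : ∀ ω, ∀ j, Δ j ω = Δ (D ω) ω → j ≤ D ω)
    -- `F ω` is the largest index attaining `max_j L j ω`
    (hFmax : ∀ ω, ∀ j, L j ω ≤ L (F ω) ω)
    (hFlast : ∀ ω, ∀ j, L j ω = L (F ω) ω → j ≤ F ω) :
    0 ≤ ∫ ω, (Δ (D ω) ω - Δ (F ω) ω) ∂μ ∧
    ∫ ω, (Δ (D ω) ω - Δ (F ω) ω) ∂μ
      ≤ 2 * ε * ∑ j : Fin m, ∑ j' : Fin m,
          if j ≠ j' then (μ {ω | |L j ω - L j' ω| ≤ 2 * ε}).toReal else 0 := by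
  classical
  have hms : ∀ j j', MeasurableSet {ω | |L j ω - L j' ω| ≤ 2 * ε} := fun j j' =>
    measurableSet_le ((hLmeas j).sub (hLmeas j')).abs measurable_const
  refine ⟨integral_nonneg fun ω => sub_nonneg.2 (hDmax ω (F ω)), ?_⟩
  let t : Fin m → Fin m → Ω → ℝ := fun j j' ω =>
    if j ≠ j' then ({ω | |L j ω - L j' ω| ≤ 2 * ε}).indicator (fun _ => (1 : ℝ)) ω else 0
  have ht0 : ∀ j j' ω, 0 ≤ t j j' ω := by
    intro j j' ω
    simp only [t]
    split_ifs
    · exact Set.indicator_nonneg (fun _ _ => zero_le_one) ω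
    · exact le_rfl
  have htint : ∀ j j', Integrable (t j j') μ := by
    intro j j'
    by_cases h : j ≠ j'
    · simp only [t, if_pos h]
      exact (integrable_const (1 : ℝ)).indicator (hms j j')
    · simp only [t, if_neg h]
      exact integrable_zero _ _ _
  have hteq : ∀ j j', ∫ ω, t j j' ω ∂μ
      = if j ≠ j' then (μ {ω | |L j ω - L j' ω| ≤ 2 * ε}).toReal else 0 := by
    intro j j'
    by_cases h : j ≠ j'
    · simp only [t, if_pos h]
      rw [integral_indicator_const (1 : ℝ) (hms j j')]
      simp [Measure.real]
    · simp only [t, if_neg h]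
      simp
  have hsum : 2 * ε * ∑ j : Fin m, ∑ j' : Fin m,
      (if j ≠ j' then (μ {ω | |L j ω - L j' ω| ≤ 2 * ε}).toReal else 0)
      = ∫ ω, 2 * ε * ∑ j : Fin m, ∑ j' : Fin m, t j j' ω ∂μ := by
    rw [integral_const_mul, integral_finset_sum _
      (fun j _ => integrable_finset_sum _ (fun j' _ => htint j j'))]
    congr 1
    refine Finset.sum_congr rfl fun j _ => ?_
    rw [integral_finset_sum _ (fun j' _ => htint j j')]
    exact Finset.sum_congr rfl fun j' _ => (hteq j j').symm
  rw [hsum]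
  refine integral_mono_of_nonneg
    (Filter.Eventually.of_forall fun ω => sub_nonneg.2 (hDmax ω (F ω)))
    ((integrable_finset_sum _
      (fun j _ => integrable_finset_sum _ (fun j' _ => htint j j'))).const_mul _) ?_
  filter_upwards [ae_all_iff.2 happrox] with ω hω
  have hS0 : 0 ≤ ∑ j : Fin m, ∑ j' : Fin m, t j j' ω :=
    Finset.sum_nonneg fun j _ => Finset.sum_nonneg fun j' _ => ht0 j j' ω
  by_cases h : D ω = F ω
  · rw [h, sub_self]
    positivity
  · have h1 := abs_le.1 (hω (D ω))
    have h2 := abs_le.1 (hω (F ω))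
    have h3 := hDmax ω (F ω)
    have h4 := hFmax ω (D ω)
    have hmem : ω ∈ {ω' | |L (D ω) ω' - L (F ω) ω'| ≤ 2 * ε} := by
      rw [Set.mem_setOf_eq, abs_le]
      constructor <;> linarith
    have h5 : t (D ω) (F ω) ω = 1 := by
      simp only [t]
      rw [if_pos h, Set.indicator_of_mem hmem]
    have h6 : t (D ω) (F ω) ω ≤ ∑ j' : Fin m, t (D ω) j' ω :=
      Finset.single_le_sum (f := fun j' => t (D ω) j' ω)
        (fun j' _ => ht0 _ j' ω) (Finset.mem_univ (F ω))
    have h7 : ∑ j' : Fin m, t (D ω) j' ω ≤ ∑ j : Fin m, ∑ j' : Fin m, t j j' ω :=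
      Finset.single_le_sum (f := fun j => ∑ j' : Fin m, t j j' ω)
        (fun j _ => Finset.sum_nonneg fun j' _ => ht0 j j' ω) (Finset.mem_univ (D ω))
    nlinarith
end

section
/- Let L₁,…,L_m and L̂₁,…,L̂_m (m ≥ 1) be integrable real random variables on a probability space. Let F be the largest index attaining max_j L_j and H the largest index attaining max_j L̂_j. Then 0 ≤ E[L_F − L_H] ≤ Σ_{j ≠ j'} E[|(L_j − L̂_j) − (L_{j'} − L̂_{j'})|·1{|L_j − L_{j'}| ≤ |(L_j − L̂_j) − (L_{j'} − L̂_{j'})|}]. -/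
open MeasureTheory

/-- **Arm-selection regret of maximizing estimated indices (term T₅ in the proof of
Theorem 4.2).**  Let `L j` and `L̂ j`, `j : Fin m` (`m ≥ 1`), be integrable real random
variables; let `F` be the largest index attaining `max_j L j` and `H` the largest index
attaining `max_j L̂ j` (pointwise).  Then
`0 ≤ E[L_F - L_H]
   ≤ Σ_{j ≠ j'} E[|(L_j - L̂_j) - (L_{j'} - L̂_{j'})| · 1{|L_j - L_{j'}| ≤ |(L_j - L̂_j) - (L_{j'} - L̂_{j'})|}]`. -/
theorem argmax_regret_estimated_index
    {Ω : Type*} [MeasurableSpace Ω] (μ : Measure Ω) [IsProbabilityMeasure μ]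
    {m : ℕ} (hm : 1 ≤ m)
    (L Lhat : Fin m → Ω → ℝ)
    (hLint : ∀ j, Integrable (L j) μ) (hLhint : ∀ j, Integrable (Lhat j) μ)
    (hLmeas : ∀ j, Measurable (L j)) (hLhmeas : ∀ j, Measurable (Lhat j))
    (F H : Ω → Fin m) (hFmeas : Measurable F) (hHmeas : Measurable H)
    -- `F ω` is the largest index attaining `max_j L j ω`
    (hFmax : ∀ ω, ∀ j, L j ω ≤ L (F ω) ω)
    (hFlast : ∀ ω, ∀ j, L j ω = L (F ω) ω → j ≤ F ω)
    -- `H ω` is the largest index attaining `max_j L̂ j ω`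
    (hHmax : ∀ ω, ∀ j, Lhat j ω ≤ Lhat (H ω) ω)
    (hHlast : ∀ ω, ∀ j, Lhat j ω = Lhat (H ω) ω → j ≤ H ω) :
    0 ≤ ∫ ω, (L (F ω) ω - L (H ω) ω) ∂μ ∧
    ∫ ω, (L (F ω) ω - L (H ω) ω) ∂μ
      ≤ ∑ j : Fin m, ∑ j' : Fin m,
          if j ≠ j' then
            ∫ ω, |(L j ω - Lhat j ω) - (L j' ω - Lhat j' ω)|
              * (if |L j ω - L j' ω| ≤ |(L j ω - Lhat j ω) - (L j' ω - Lhat j' ω)| then (1:ℝ) else 0) ∂μ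
          else 0 := by
  have hf0 : ∀ ω, 0 ≤ L (F ω) ω - L (H ω) ω := fun ω => sub_nonneg.2 (hFmax ω _)
  refine ⟨integral_nonneg hf0, ?_⟩
  set G : Fin m → Fin m → Ω → ℝ := fun j j' ω =>
    |(L j ω - Lhat j ω) - (L j' ω - Lhat j' ω)|
      * (if |L j ω - L j' ω| ≤ |(L j ω - Lhat j ω) - (L j' ω - Lhat j' ω)| then (1:ℝ) else 0)
    with hG
  have hG0 : ∀ j j' ω, 0 ≤ G j j' ω := by
    intro j j' ω
    simp only [hG]
    split_ifs <;> simp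
  have hGint : ∀ j j', Integrable (G j j') μ := by
    intro j j'
    have hD : Integrable (fun ω => |(L j ω - Lhat j ω) - (L j' ω - Lhat j' ω)|) μ :=
      (((hLint j).sub (hLhint j)).sub ((hLint j').sub (hLhint j'))).abs
    have hDm : Measurable (fun ω => |(L j ω - Lhat j ω) - (L j' ω - Lhat j' ω)|) :=
      (((hLmeas j).sub (hLhmeas j)).sub ((hLmeas j').sub (hLhmeas j'))).abs
    have hEm : Measurable (fun ω => |L j ω - L j' ω|) := ((hLmeas j).sub (hLmeas j')).abs
    have hm1 : Measurable (G j j') :=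
      hDm.mul (Measurable.ite (measurableSet_le hEm hDm) measurable_const measurable_const)
    refine hD.mono' hm1.aestronglyMeasurable (Filter.Eventually.of_forall fun ω => ?_)
    rw [Real.norm_of_nonneg (hG0 j j' ω)]
    simp only [hG]
    split_ifs <;> simp
  have hKint : ∀ j j', Integrable (fun ω => if j ≠ j' then G j j' ω else 0) μ := by
    intro j j'
    by_cases h : j ≠ j'
    · simpa only [if_pos h] using hGint j j'
    · simp only [if_neg h]
      exact integrable_zero _ _ _
  have hK0 : ∀ j j' ω, 0 ≤ (if j ≠ j' then G j j' ω else 0) := by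
    intro j j' ω
    split_ifs
    · exact hG0 j j' ω
    · exact le_rfl
  have hsum : (∑ j : Fin m, ∑ j' : Fin m, if j ≠ j' then ∫ ω, G j j' ω ∂μ else 0)
      = ∫ ω, ∑ j : Fin m, ∑ j' : Fin m, (if j ≠ j' then G j j' ω else 0) ∂μ := by
    rw [integral_finsetSum _ fun j _ => integrable_finsetSum _ fun j' _ => hKint j j']
    refine Finset.sum_congr rfl fun j _ => ?_
    rw [integral_finsetSum _ fun j' _ => hKint j j']
    refine Finset.sum_congr rfl fun j' _ => ?_
    by_cases h : j ≠ j'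
    · simp only [if_pos h]
    · simp only [if_neg h, integral_zero]
  refine le_trans ?_ hsum.ge
  refine integral_mono_of_nonneg (Filter.Eventually.of_forall hf0)
    (integrable_finsetSum _ fun j _ => integrable_finsetSum _ fun j' _ => hKint j j')
    (Filter.Eventually.of_forall fun ω => ?_)
  have h1 : L (F ω) ω - L (H ω) ω ≤ (if F ω ≠ H ω then G (F ω) (H ω) ω else 0) := by
    by_cases h : F ω ≠ H ω
    · rw [if_pos h]
      have h2 : L (F ω) ω - L (H ω) ω
          ≤ |(L (F ω) ω - Lhat (F ω) ω) - (L (H ω) ω - Lhat (H ω) ω)| :=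
        le_trans (by linarith [hHmax ω (F ω)]) (le_abs_self _)
      have h3 : |L (F ω) ω - L (H ω) ω|
          ≤ |(L (F ω) ω - Lhat (F ω) ω) - (L (H ω) ω - Lhat (H ω) ω)| := by
        rwa [abs_of_nonneg (hf0 ω)]
      simp only [hG]
      rw [if_pos h3, mul_one]
      exact h2
    · rw [if_neg h, not_not.1 h, sub_self]
  refine h1.trans ?_
  refine le_trans ?_ (Finset.single_le_sum
    (f := fun j => ∑ j' : Fin m, (if j ≠ j' then G j j' ω else 0))
    (fun j _ => Finset.sum_nonneg fun j' _ => hK0 j j' ω) (Finset.mem_univ (F ω)))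
  exact Finset.single_le_sum (f := fun j' => (if F ω ≠ j' then G (F ω) j' ω else 0))
    (fun j' _ => hK0 (F ω) j' ω) (Finset.mem_univ (H ω))
end
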